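/- For every integer k ≥ 1 and every real x with 0 < x < 1, the (k+1)-st derivative of the function y ↦ H(y^k), evaluated at x, equals -k·k! · ∑_{ℓ=0}^{∞} binom(k+kℓ-1, k-1) · x^{kℓ-1}, where binom denotes the ordinary binomial coefficient. -/

import Mathlib

theorem summable_descFactorial_mul_pow {e : ℕ → ℕ} (he : Function.Injective e) (m : ℕ)
    {r : ℝ} (hr0 : 0 < r) (hr1 : r < 1) :
    Summable fun n ↦ ((e n).descFactorial m : ℝ) * r ^ (e n - m) := by
  have hs : Summable fun n : ℕ ↦ (n : ℝ) ^ m * r ^ n :=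
    summable_pow_mul_geometric_of_norm_lt_one m (by rwa [Real.norm_of_nonneg hr0.le])
  refine .of_nonneg_of_le (fun n ↦ by positivity) (fun n ↦ ?_)
    ((hs.comp_injective he).mul_right (r ^ m)⁻¹)
  simp only [Function.comp_apply]
  rcases lt_or_ge (e n) m with h | h
  · rw [Nat.descFactorial_of_lt h]
    simp only [Nat.cast_zero, zero_mul]
    positivity
  · rw [mul_assoc, ← pow_sub₀ r hr0.ne' h]
    gcongr
    exact_mod_cast Nat.descFactorial_le_pow _ _

theorem iteratedDerivWithin_mul_pow {s : Set ℝ} (hs : IsOpen s) (c : ℝ) (e m : ℕ) :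
    Set.EqOn (iteratedDerivWithin m (fun y : ℝ ↦ c * y ^ e) s)
      (fun y ↦ c * ((e.descFactorial m : ℝ) * y ^ (e - m))) s := by
  intro y hy
  rw [iteratedDerivWithin_of_isOpen hs hy, iteratedDeriv_const_mul_field]
  congr 1
  exact iteratedDeriv_pow e m

theorem iteratedDeriv_tsum_mul_pow {c : ℕ → ℝ} (hc : ∀ n, |c n| ≤ 1) {e : ℕ → ℕ}
    (he : Function.Injective e) (m : ℕ) {x : ℝ} (hx : x ∈ Set.Ioo (0 : ℝ) 1) :
    iteratedDeriv m (fun y : ℝ ↦ ∑' n, c n * y ^ e n) x =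
      ∑' n, c n * (((e n).descFactorial m : ℝ) * x ^ (e n - m)) := by
  have ho : IsOpen (Set.Ioo (0 : ℝ) 1) := isOpen_Ioo
  have hbound (j n : ℕ) {y r : ℝ} (hy : 0 < y) (hyr : y ≤ r) :
      ‖c n * (((e n).descFactorial j : ℝ) * y ^ (e n - j))‖ ≤
        ((e n).descFactorial j : ℝ) * r ^ (e n - j) := by
    rw [norm_mul, Real.norm_eq_abs, Real.norm_of_nonneg (by positivity)]
    calc _ ≤ 1 * (((e n).descFactorial j : ℝ) * y ^ (e n - j)) := by gcongr; exact hc n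
      _ ≤ _ := by rw [one_mul]; gcongr
  rw [← iteratedDerivWithin_of_isOpen ho hx, iteratedDerivWithin_tsum m ho hx]
  · exact tsum_congr fun n ↦ iteratedDerivWithin_mul_pow ho _ _ _ hx
  · intro t ht
    refine .of_norm_bounded (summable_descFactorial_mul_pow he 0 ht.1 ht.2) fun n ↦ ?_
    simpa using hbound 0 n ht.1 le_rfl
  · intro j _ _
    refine SummableLocallyUniformlyOn_of_locally_bounded ho fun K hK hKc ↦ ?_
    obtain rfl | hne := K.eq_empty_or_nonempty
    · exact ⟨0, summable_zero, by simp⟩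
    obtain ⟨r, hrK, hr⟩ := hKc.exists_isGreatest hne
    refine ⟨_, summable_descFactorial_mul_pow he j (hK hrK).1 (hK hrK).2, fun n y hy ↦ ?_⟩
    rw [iteratedDerivWithin_mul_pow ho _ _ _ (hK hy)]
    exact hbound j n (hK hy).1 (hr hy)
  · intro n j r _ hr
    refine DifferentiableAt.congr_of_eventuallyEq ?_
      ((iteratedDerivWithin_mul_pow ho _ _ _).eventuallyEq_of_mem (ho.mem_nhds hr))
    fun_prop

theorem hasSum_pow_div_add_one_sub_mul_log {u : ℝ} (hu : |u| < 1) :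
    HasSum (fun n : ℕ ↦ (((n : ℝ) + 2) * (n + 1))⁻¹ * u ^ (n + 2))
      (u + (1 - u) * Real.log (1 - u)) := by
  have h := Real.hasSum_pow_div_log_of_abs_lt_one hu
  have h' := (hasSum_nat_add_iff' 1).mpr h
  have := (h.mul_left u).sub h'
  simp only [Finset.range_one, Finset.sum_singleton] at this
  rw [show u + (1 - u) * Real.log (1 - u) =
    u * -Real.log (1 - u) - (-Real.log (1 - u) - u ^ (0 + 1) / (((0 : ℕ) : ℝ) + 1)) by
      norm_num; ring]
  refine this.congr_fun fun n ↦ ?_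
  have h₁ : (n : ℝ) + 1 ≠ 0 := by positivity
  have h₂ : (n : ℝ) + 2 ≠ 0 := by positivity
  have h₃ : ((n + 1 : ℕ) : ℝ) + 1 = n + 2 := by push_cast; ring
  rw [h₃]
  field_simp
  ring

theorem iteratedDeriv_succ_pow_mul_log (k : ℕ) {x : ℝ} (hx : 0 < x) :
    iteratedDeriv (k + 1) (fun y : ℝ ↦ y ^ k * Real.log y) x = k.factorial / x := by
  induction k with
  | zero => simp [iteratedDeriv_one]
  | succ k ih =>
    have hd : deriv (fun y : ℝ ↦ y ^ (k + 1) * Real.log y) =ᶠ[nhds x]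
        fun y ↦ (k + 1 : ℝ) * (y ^ k * Real.log y) + y ^ k := by
      filter_upwards [lt_mem_nhds hx] with y hy
      have := (hasDerivAt_pow (k + 1) y).mul (Real.hasDerivAt_log hy.ne')
      refine (this.deriv).trans ?_
      rw [Nat.add_sub_cancel]
      push_cast
      field_simp
      ring
    have hl : ContDiffAt ℝ (k + 1 : ℕ) (fun y : ℝ ↦ y ^ k * Real.log y) x :=
      (contDiffAt_id.pow k).mul (contDiffAt_id.log hx.ne')
    rw [iteratedDeriv_succ', hd.iteratedDeriv_eq, iteratedDeriv_fun_add (contDiffAt_const.mul hl)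
      (by fun_prop), iteratedDeriv_const_mul_field, ih, iteratedDeriv_pow,
      Nat.descFactorial_of_lt k.lt_succ_self, Nat.factorial_succ]
    push_cast
    ring

theorem descFactorial_mul_add_two (k : ℕ) (hk : 1 ≤ k) (n : ℕ) :
    (k * (n + 2)).descFactorial (k + 1) =
      k * (n + 2) * (k * (n + 1)) * ((k - 1).factorial * (k + k * (n + 1) - 1).choose (k - 1)) := by
  obtain ⟨k, rfl⟩ := Nat.exists_eq_add_of_le' hk
  rw [← Nat.descFactorial_eq_factorial_mul_choose]
  have h : (k + 1) * (n + 2) = (k + (k + 1) * (n + 1)) + 1 := by ring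
  rw [h, Nat.succ_descFactorial_succ, Nat.descFactorial_succ]
  simp only [Nat.add_sub_cancel, Nat.add_sub_cancel_left]
  rw [show k + 1 + (k + 1) * (n + 1) - 1 = k + (k + 1) * (n + 1) by omega]
  ring

theorem binEntropy_pow_decomposition (k : ℕ) (y : ℝ) :
    Real.binEntropy (y ^ k) = y ^ k - k * (y ^ k * Real.log y) -
      (y ^ k + (1 - y ^ k) * Real.log (1 - y ^ k)) := by
  rw [Real.binEntropy, Real.log_inv, Real.log_inv, Real.log_pow]
  ring

/-- For every integer `k ≥ 1` and real `0 < x < 1`, the `(k+1)`-st derivative of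
`y ↦ H(y^k)` at `x` equals `-k·k! · ∑_{ℓ=0}^∞ C(k+kℓ-1, k-1) · x^{kℓ-1}`. -/
theorem stmt5 (k : ℕ) (hk : 1 ≤ k) (x : ℝ) (hx0 : 0 < x) (hx1 : x < 1) :
    iteratedDeriv (k + 1) (fun y : ℝ => Real.binEntropy (y ^ k)) x
      = -(k * Nat.factorial k : ℝ)
          * ∑' ℓ : ℕ, ((k + k * ℓ - 1).choose (k - 1) : ℝ) * x ^ ((k * ℓ : ℤ) - 1) := by
  have hk0 : k ≠ 0 := by omega
  have hkR : (k : ℝ) ≠ 0 := by exact_mod_cast hk0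
  have hxk : x ^ k < 1 := pow_lt_one₀ hx0.le hx1 hk0
  have he : Function.Injective fun n : ℕ ↦ k * (n + 2) := fun a b h ↦ by
    simpa [hk0] using h
  have hc (n : ℕ) : |(((n : ℝ) + 2) * (n + 1))⁻¹| ≤ 1 := by
    rw [abs_of_nonneg (by positivity)]
    exact inv_le_one_of_one_le₀ (by nlinarith [(n.cast_nonneg : (0 : ℝ) ≤ n)])
  have hlog : ContDiffAt ℝ (k + 1 : ℕ) (fun y : ℝ ↦ (k : ℝ) * (y ^ k * Real.log y)) x :=
    contDiffAt_const.mul ((contDiffAt_id.pow k).mul (contDiffAt_id.log hx0.ne'))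
  have hpow : ContDiffAt ℝ (k + 1 : ℕ) (fun y : ℝ ↦ y ^ k) x := contDiffAt_id.pow k
  have hlog' : ContDiffAt ℝ (k + 1 : ℕ)
      (fun y : ℝ ↦ y ^ k + (1 - y ^ k) * Real.log (1 - y ^ k)) x :=
    hpow.add ((contDiffAt_const.sub hpow).mul
      ((contDiffAt_const.sub hpow).log (sub_pos.mpr hxk).ne'))
  have hser : (fun y : ℝ ↦ y ^ k + (1 - y ^ k) * Real.log (1 - y ^ k)) =ᶠ[nhds x]
      fun y ↦ ∑' n : ℕ, (((n : ℝ) + 2) * (n + 1))⁻¹ * y ^ (k * (n + 2)) := by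
    filter_upwards [isOpen_Ioo.mem_nhds (Set.mem_Ioo.mpr ⟨hx0, hx1⟩)] with y hy
    have hy' : |y ^ k| < 1 := by
      rw [abs_of_nonneg (pow_nonneg hy.1.le k)]
      exact pow_lt_one₀ hy.1.le hy.2 hk0
    simp_rw [pow_mul]
    exact (hasSum_pow_div_add_one_sub_mul_log hy').tsum_eq.symm
  have hterm (n : ℕ) : (((n : ℝ) + 2) * (n + 1))⁻¹ *
      (((k * (n + 2)).descFactorial (k + 1) : ℝ) * x ^ (k * (n + 2) - (k + 1))) =
      (k * k.factorial : ℝ) * (((k + k * (n + 1) - 1).choose (k - 1) : ℝ) *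
        x ^ ((k * (n + 1 : ℕ) : ℤ) - 1)) := by
    have hexp : x ^ ((k * (n + 1 : ℕ) : ℤ) - 1) = x ^ (k * (n + 2) - (k + 1)) := by
      rw [← zpow_natCast]
      congr 1
      have : k + 1 ≤ k * (n + 2) := by nlinarith
      push_cast [Nat.cast_sub this]
      ring
    rw [hexp, descFactorial_mul_add_two k hk, ← Nat.mul_factorial_pred hk0]
    push_cast
    field_simp
  have hsum : Summable fun n : ℕ ↦ ((k + k * (n + 1) - 1).choose (k - 1) : ℝ) *
      x ^ ((k * (n + 1 : ℕ) : ℤ) - 1) := by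
    have hkf : (k * k.factorial : ℝ) ≠ 0 := by positivity
    rw [← summable_mul_left_iff hkf]
    simp_rw [← hterm]
    refine .of_norm_bounded (summable_descFactorial_mul_pow he (k + 1) hx0 hx1) fun n ↦ ?_
    rw [norm_mul, Real.norm_eq_abs, Real.norm_of_nonneg (by positivity)]
    exact mul_le_of_le_one_left (by positivity) (hc n)
  rw [((summable_nat_add_iff (f := fun ℓ : ℕ ↦ ((k + k * ℓ - 1).choose (k - 1) : ℝ) *
    x ^ ((k * ℓ : ℤ) - 1)) 1).mp hsum).tsum_eq_zero_add]
  simp_rw [binEntropy_pow_decomposition]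
  rw [iteratedDeriv_fun_sub (hpow.sub hlog) hlog', iteratedDeriv_fun_sub hpow hlog,
    iteratedDeriv_const_mul_field, iteratedDeriv_succ_pow_mul_log k hx0, iteratedDeriv_pow,
    Nat.descFactorial_of_lt k.lt_succ_self, hser.iteratedDeriv_eq,
    iteratedDeriv_tsum_mul_pow hc he (k + 1) ⟨hx0, hx1⟩]
  simp_rw [hterm]
  rw [tsum_mul_left]
  simp
  ring
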